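/- Let k ∈ ℕ, let f : ℝ → ℝ be a 2π-periodic C^k function, let z₁, …, z_M ∈ ℝ be finitely many points, and let ε > 0. Then there exists a trigonometric polynomial p such that p^{(i)}(z_j) = f^{(i)}(z_j) for all 0 ≤ i ≤ k and all j = 1, …, M, and |f − p|_k < ε. -/

import Mathlib

/-- A trigonometric polynomial: a function of the form
`t ↦ a 0 + ∑_{j=1}^{N} (a j * cos (j t) + b j * sin (j t))` with real coefficients. -/
def IsTrigPoly (p : ℝ → ℝ) : Prop :=
  ∃ (N : ℕ) (a b : ℕ → ℝ), ∀ t : ℝ,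
    p t = a 0 + ∑ j ∈ Finset.Icc 1 N, (a j * Real.cos (j * t) + b j * Real.sin (j * t))

open Function Metric

lemma IsTrigPoly.const (c : ℝ) : IsTrigPoly fun _ => c :=
  ⟨0, fun _ => c, 0, by simp⟩

lemma IsTrigPoly.const_mul {p : ℝ → ℝ} (hp : IsTrigPoly p) (c : ℝ) :
    IsTrigPoly fun t => c * p t := by
  obtain ⟨N, a, b, h⟩ := hp
  refine ⟨N, fun j => c * a j, fun j => c * b j, fun t => ?_⟩
  simp only [h, mul_add, Finset.mul_sum, mul_assoc]

/-- The degree bound of a trigonometric polynomial may be enlarged. -/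
lemma IsTrigPoly.exists_le {p : ℝ → ℝ} (hp : IsTrigPoly p) :
    ∃ N : ℕ, ∀ n ≥ N, ∃ a b : ℕ → ℝ, ∀ t : ℝ,
      p t = a 0 + ∑ j ∈ Finset.Icc 1 n, (a j * Real.cos (j * t) + b j * Real.sin (j * t)) := by
  obtain ⟨N, a, b, h⟩ := hp
  refine ⟨N, fun n hn => ⟨fun j => if j ≤ N then a j else 0, fun j => if j ≤ N then b j else 0,
    fun t => ?_⟩⟩
  simp only [h t, Nat.zero_le, if_true]
  congr 1
  rw [← Finset.sum_subset (Finset.Icc_subset_Icc_right hn)]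
  · refine Finset.sum_congr rfl fun j hj => ?_
    simp [(Finset.mem_Icc.1 hj).2]
  · intro j hj hj'
    have : ¬ j ≤ N := fun hle => hj' (Finset.mem_Icc.2 ⟨(Finset.mem_Icc.1 hj).1, hle⟩)
    simp [this]

lemma IsTrigPoly.add {p q : ℝ → ℝ} (hp : IsTrigPoly p) (hq : IsTrigPoly q) :
    IsTrigPoly fun t => p t + q t := by
  obtain ⟨N, hN⟩ := hp.exists_le
  obtain ⟨N', hN'⟩ := hq.exists_le
  obtain ⟨a, b, h⟩ := hN (max N N') (le_max_left _ _)
  obtain ⟨a', b', h'⟩ := hN' (max N N') (le_max_right _ _)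
  refine ⟨max N N', fun j => a j + a' j, fun j => b j + b' j, fun t => ?_⟩
  simp only [h t, h' t]
  rw [add_add_add_comm, ← Finset.sum_add_distrib]
  congr 1
  exact Finset.sum_congr rfl fun j _ => by ring

lemma IsTrigPoly.cos_nat_mul (n : ℕ) : IsTrigPoly fun t => Real.cos (n * t) := by
  rcases Nat.eq_zero_or_pos n with rfl | hn
  · simpa using IsTrigPoly.const 1
  · refine ⟨n, Pi.single n 1, 0, fun t => ?_⟩
    rw [Finset.sum_eq_single n]
    · simp [hn.ne]
    · intro j _ hj
      simp [hj]
    · simp [hn.ne']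

lemma IsTrigPoly.sin_nat_mul (n : ℕ) : IsTrigPoly fun t => Real.sin (n * t) := by
  rcases Nat.eq_zero_or_pos n with rfl | hn
  · simpa using IsTrigPoly.const 0
  · refine ⟨n, 0, Pi.single n 1, fun t => ?_⟩
    rw [Finset.sum_eq_single n]
    · simp
    · intro j _ hj
      simp [hj]
    · simp [hn.ne']

lemma IsTrigPoly.cos_int_mul (n : ℤ) : IsTrigPoly fun t => Real.cos (n * t) := by
  obtain ⟨m, rfl | rfl⟩ := n.eq_nat_or_neg
  · simpa using IsTrigPoly.cos_nat_mul m
  · simpa using IsTrigPoly.cos_nat_mul m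

lemma IsTrigPoly.sin_int_mul (n : ℤ) : IsTrigPoly fun t => Real.sin (n * t) := by
  obtain ⟨m, rfl | rfl⟩ := n.eq_nat_or_neg
  · simpa using IsTrigPoly.sin_nat_mul m
  · simpa using (IsTrigPoly.sin_nat_mul m).const_mul (-1)

lemma IsTrigPoly.contDiff {p : ℝ → ℝ} (hp : IsTrigPoly p) (n : ℕ) : ContDiff ℝ n p := by
  obtain ⟨N, a, b, h⟩ := hp
  rw [funext h]
  fun_prop

lemma IsTrigPoly.periodic {p : ℝ → ℝ} (hp : IsTrigPoly p) : Periodic p (2 * Real.pi) := by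
  obtain ⟨N, a, b, h⟩ := hp
  intro t
  simp only [h, mul_add, Real.cos_add_nat_mul_two_pi, Real.sin_add_nat_mul_two_pi]

/-- Up to its constant term, every trigonometric polynomial is the derivative of another one. -/
lemma IsTrigPoly.exists_hasDerivAt {p : ℝ → ℝ} (hp : IsTrigPoly p) :
    ∃ (q : ℝ → ℝ) (c : ℝ), IsTrigPoly q ∧ ∀ t, HasDerivAt q (p t - c) t := by
  obtain ⟨N, a, b, h⟩ := hp
  refine ⟨fun t => ∑ j ∈ Finset.Icc 1 N,
    (-(b j / j) * Real.cos (j * t) + a j / j * Real.sin (j * t)), a 0,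
    ⟨N, fun j => -(b j / j), fun j => a j / j, fun t => by simp⟩, fun t => ?_⟩
  rw [h t, add_sub_cancel_left]
  refine HasDerivAt.fun_sum fun j hj => ?_
  have hj0 : (j : ℝ) ≠ 0 := Nat.cast_ne_zero.2 (Nat.one_le_iff_ne_zero.1 (Finset.mem_Icc.1 hj).1)
  have hd : HasDerivAt (fun t : ℝ => (j : ℝ) * t) j t := by
    simpa using (hasDerivAt_id t).const_mul (j : ℝ)
  convert (hd.cos.const_mul (-(b j / j))).fun_add (hd.sin.const_mul (a j / j)) using 1
  field_simp
  ring

/-- Uniform density of trigonometric polynomials among continuous periodic functions. -/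
lemma exists_isTrigPoly_abs_sub_lt {f : ℝ → ℝ} (hf : Continuous f)
    (hper : Periodic f (2 * Real.pi)) {ε : ℝ} (hε : 0 < ε) :
    ∃ p, IsTrigPoly p ∧ ∀ x, |f x - p x| < ε := by
  have : Fact (0 < 2 * Real.pi) := ⟨Real.two_pi_pos⟩
  let g : C(AddCircle (2 * Real.pi), ℂ) :=
    ⟨fun x => (hper.lift x : ℂ),
      Complex.continuous_ofReal.comp (continuous_coinduced_dom.2 hf)⟩
  have hg : g ∈ closure
      (Submodule.span ℂ (Set.range (@fourier (2 * Real.pi))) : Set C(AddCircle _, ℂ)) := by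
    rw [← Submodule.topologicalClosure_coe, span_fourier_closure_eq_top]
    trivial
  obtain ⟨h, hh, hlt⟩ := Metric.mem_closure_iff.1 hg ε hε
  have key : IsTrigPoly (fun t : ℝ => (h t).re) ∧ IsTrigPoly (fun t : ℝ => (h t).im) := by
    clear hlt
    induction hh using Submodule.span_induction with
    | mem x hx =>
      obtain ⟨n, rfl⟩ := hx
      have he (t : ℝ) : fourier n (t : AddCircle (2 * Real.pi))
          = Complex.exp ((n * t : ℝ) * Complex.I) := by
        rw [fourier_coe_apply]
        congr 1
        push_cast
        have : (Real.pi : ℂ) ≠ 0 := by exact_mod_cast Real.pi_ne_zero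
        field_simp
      simp only [he, Complex.exp_ofReal_mul_I_re, Complex.exp_ofReal_mul_I_im]
      exact ⟨.cos_int_mul n, .sin_int_mul n⟩
    | zero => exact ⟨by simpa using IsTrigPoly.const 0, by simpa using IsTrigPoly.const 0⟩
    | add x y _ _ hx hy =>
      exact ⟨by simpa using hx.1.add hy.1, by simpa using hx.2.add hy.2⟩
    | smul c x _ hx =>
      refine ⟨?_, by simpa using (hx.2.const_mul c.re).add (hx.1.const_mul c.im)⟩
      simpa [sub_eq_add_neg] using (hx.1.const_mul c.re).add (hx.2.const_mul (-c.im))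
  refine ⟨_, key.1, fun x => ?_⟩
  calc |f x - (h x).re| = |(g x - h x).re| := by
        simp [g]
    _ ≤ ‖g x - h x‖ := Complex.abs_re_le_norm _
    _ ≤ dist g h := by rw [← dist_eq_norm]; exact ContinuousMap.dist_apply_le_dist _
    _ < ε := hlt

/-- Density of trigonometric polynomials among `2π`-periodic `C^k` functions in `C^k`-norm. -/
lemma exists_isTrigPoly_abs_iteratedDeriv_sub_lt (k : ℕ) {f : ℝ → ℝ} (hf : ContDiff ℝ k f)
    (hper : Periodic f (2 * Real.pi)) {ε : ℝ} (hε : 0 < ε) :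
    ∃ p, IsTrigPoly p ∧ ∀ i ≤ k, ∀ x, |iteratedDeriv i f x - iteratedDeriv i p x| < ε := by
  induction k generalizing f ε with
  | zero =>
    obtain ⟨p, hp, h⟩ := exists_isTrigPoly_abs_sub_lt hf.continuous hper hε
    refine ⟨p, hp, fun i hi x => ?_⟩
    obtain rfl := Nat.le_zero.1 hi
    simpa using h x
  | succ k ih =>
    have hπ := Real.pi_gt_three
    have hfd : Differentiable ℝ f := hf.differentiable (by simp)
    have hf' : ContDiff ℝ k (deriv f) := by
      have := (contDiff_succ_iff_deriv (n := (k : WithTop ℕ∞))).1 (by exact_mod_cast hf)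
      exact this.2.2
    have hper' : Periodic (deriv f) (2 * Real.pi) := fun x => by
      rw [← deriv_comp_add_const, funext hper]
    set δ := ε / (8 * Real.pi) with hδ
    have hδ0 : 0 < δ := by positivity
    have hδε : 2 * δ * (2 * Real.pi) < ε := by rw [hδ]; field_simp; norm_num
    have hδε' : 2 * δ < ε := by nlinarith
    obtain ⟨q, hq, hqf⟩ := ih hf' hper' hδ0
    obtain ⟨Q, c, hQ, hQd⟩ := hq.exists_hasDerivAt
    have hgd (x : ℝ) : HasDerivAt (fun x => f x - Q x) (deriv f x - (q x - c)) x :=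
      (hfd x).hasDerivAt.sub (hQd x)
    have hgper : Periodic (fun x => f x - Q x) (2 * Real.pi) := hper.sub hQ.periodic
    have hq0 (x : ℝ) : |deriv f x - q x| < δ := by simpa using hqf 0 (Nat.zero_le _) x
    have hc : |c| < δ := by
      obtain ⟨x, -, hx⟩ := exists_hasDerivAt_eq_zero (f := fun x => f x - Q x) Real.two_pi_pos
        (fun x _ => (hgd x).continuousAt.continuousWithinAt) (by simpa using (hgper 0).symm)
        (fun x _ => hgd x)
      rw [← abs_neg, show -c = deriv f x - q x by linarith]
      exact hq0 x
    have hg' (x : ℝ) : |deriv f x - (q x - c)| < 2 * δ := by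
      rw [show deriv f x - (q x - c) = deriv f x - q x + c by ring]
      linarith [abs_add_le (deriv f x - q x) c, hq0 x]
    have hg (x : ℝ) : |f x - Q x - (f 0 - Q 0)| < ε := by
      obtain ⟨y, hy, hxy⟩ := hgper.exists_mem_Ico₀ Real.two_pi_pos x
      rw [hxy]
      have := convex_univ.norm_image_sub_le_of_norm_hasDerivWithin_le
        (f := fun x => f x - Q x) (x := 0) (y := y)
        (fun x _ => (hgd x).hasDerivWithinAt) (fun x _ => (hg' x).le) trivial trivial
      rw [Real.norm_eq_abs, Real.norm_eq_abs, sub_zero, abs_of_nonneg hy.1] at this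
      nlinarith [hy.2]
    refine ⟨_, hQ.add (.const (f 0 - Q 0)), fun i hi x => ?_⟩
    cases i with
    | zero =>
      simp only [iteratedDeriv_zero]
      rw [← sub_sub]
      exact hg x
    | succ i =>
      have hd : deriv (fun t => Q t + (f 0 - Q 0)) = fun t => -c + q t := by
        ext t
        rw [((hQd t).add_const _).deriv]
        ring
      rw [iteratedDeriv_succ', iteratedDeriv_succ', hd]
      rcases Nat.eq_zero_or_pos i with rfl | hi0
      · simp only [iteratedDeriv_zero]
        rw [neg_add_eq_sub]
        exact (hg' x).trans hδε'
      · rw [iteratedDeriv_const_add hi0]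
        linarith [hqf i (Nat.succ_le_succ_iff.1 hi) x]

/-- Points in the closure of a submodule can be approximated from the submodule subject to
finitely many continuous linear constraints. -/
lemma Submodule.exists_mem_map_eq_norm_sub_lt {E F : Type*} [NormedAddCommGroup E]
    [NormedSpace ℝ E] [NormedAddCommGroup F] [NormedSpace ℝ F] [FiniteDimensional ℝ F]
    (D : Submodule ℝ E) (L : E →L[ℝ] F) {x : E} (hx : x ∈ closure (D : Set E)) {ε : ℝ}
    (hε : 0 < ε) : ∃ d ∈ D, L d = L x ∧ ‖x - d‖ < ε := by
  let T : D →ₗ[ℝ] F := L.toLinearMap ∘ₗ D.subtype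
  have hT {y : E} (hy : y ∈ D) : L y ∈ LinearMap.range T := ⟨⟨y, hy⟩, rfl⟩
  have hLx : L x ∈ LinearMap.range T := by
    have hcl : IsClosed (LinearMap.range T : Set F) := Submodule.closed_of_finiteDimensional _
    have := map_mem_closure L.continuous hx fun y hy => hT hy
    rwa [hcl.closure_eq] at this
  obtain ⟨g, hg⟩ := T.rangeRestrict.exists_rightInverse_of_surjective T.range_rangeRestrict
  let G : LinearMap.range T →L[ℝ] D := LinearMap.toContinuousLinearMap g
  have hG (v : LinearMap.range T) : L (G v) = v :=
    congrArg Subtype.val (LinearMap.congr_fun hg v)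
  obtain ⟨d, hd, hxd⟩ := Metric.mem_closure_iff.1 hx (ε / (1 + ‖G‖ * ‖L‖)) (by positivity)
  rw [dist_eq_norm, lt_div_iff₀ (by positivity)] at hxd
  let v : LinearMap.range T := ⟨L x - L d, sub_mem hLx (hT hd)⟩
  refine ⟨d + G v, add_mem hd (G v).2, by rw [map_add, hG]; simp [v], ?_⟩
  have hv : ‖v‖ ≤ ‖L‖ * ‖x - d‖ := by
    change ‖L x - L d‖ ≤ _
    rw [← map_sub]
    exact L.le_opNorm _
  calc ‖x - (d + G v)‖ ≤ ‖x - d‖ + ‖(G v : E)‖ := by rw [← sub_sub]; exact norm_sub_le _ _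
    _ ≤ ‖x - d‖ + ‖G‖ * (‖L‖ * ‖x - d‖) := by
        gcongr
        exact (G.le_opNorm v).trans (by gcongr)
    _ < ε := by linarith

/-- The derivatives up to order `k` of a periodic `C^k` function, as bounded functions. -/
lemma Function.Periodic.exists_boundedContinuousFunction_eq_iteratedDeriv {f : ℝ → ℝ} {c : ℝ}
    {k : ℕ} (hper : Periodic f c) (hc : c ≠ 0) (hf : ContDiff ℝ k f) :
    ∃ e : Fin (k + 1) → BoundedContinuousFunction ℝ ℝ,
      ∀ (i : Fin (k + 1)) x, e i x = iteratedDeriv i f x := by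
  have hcont (i : Fin (k + 1)) : Continuous (iteratedDeriv i f) :=
    hf.continuous_iteratedDeriv i (by exact_mod_cast Nat.le_of_lt_succ i.2)
  have hp (i : ℕ) : Periodic (iteratedDeriv i f) c := fun x => by
    rw [← congrFun (iteratedDeriv_comp_add_const i f c) x, funext hper]
  have hb (i : Fin (k + 1)) := isBounded_range_iff.1 ((hp i).isBounded_of_continuous hc (hcont i))
  choose C hC using hb
  exact ⟨fun i => BoundedContinuousFunction.mkOfBound ⟨_, hcont i⟩ (C i) (hC i), fun _ _ => rfl⟩

/-- Simultaneous trigonometric interpolation and approximation: for a `2π`-periodic `C^k`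
function `f : ℝ → ℝ`, finitely many points `z 1, …, z M` and `ε > 0`, there is a trigonometric
polynomial `p` whose derivatives up to order `k` agree with those of `f` at each `z j`, and
which is `ε`-close to `f` in the `C^k`-norm. -/
theorem trig_interpolation_and_approximation
    (k : ℕ) (f : ℝ → ℝ) (hf : ContDiff ℝ k f)
    (hper : ∀ x : ℝ, f (x + 2 * Real.pi) = f x)
    (M : ℕ) (z : Fin M → ℝ) (ε : ℝ) (hε : 0 < ε) :
    ∃ p : ℝ → ℝ, IsTrigPoly p ∧
      (∀ i ≤ k, ∀ j : Fin M, iteratedDeriv i p (z j) = iteratedDeriv i f (z j)) ∧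
      (∀ i ≤ k, ∀ x : ℝ, |iteratedDeriv i f x - iteratedDeriv i p x| < ε) := by
  let E := Fin (k + 1) → BoundedContinuousFunction ℝ ℝ
  let D : Submodule ℝ E :=
    { carrier := {e | ∃ p, IsTrigPoly p ∧ ∀ (i : Fin (k + 1)) x, e i x = iteratedDeriv i p x}
      zero_mem' := ⟨_, .const 0, fun i x => by simp; rfl⟩
      add_mem' := by
        rintro e e' ⟨p, hp, he⟩ ⟨q, hq, he'⟩
        refine ⟨_, hp.add hq, fun i x => ?_⟩
        have := iteratedDeriv_add (hp.contDiff i).contDiffAt (hq.contDiff i).contDiffAt (x := x)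
        change e i x + e' i x = _
        rw [he, he', ← this]
        rfl
      smul_mem' := by
        rintro c e ⟨p, hp, he⟩
        refine ⟨_, hp.const_mul c, fun i x => ?_⟩
        change c * e i x = _
        rw [he, iteratedDeriv_const_mul_field] }
  let L : E →L[ℝ] (Fin (k + 1) × Fin M → ℝ) := ContinuousLinearMap.pi fun s =>
    (BoundedContinuousFunction.evalCLM ℝ (z s.2)).comp (ContinuousLinearMap.proj s.1)
  obtain ⟨e, he⟩ := Periodic.exists_boundedContinuousFunction_eq_iteratedDeriv hper
    Real.two_pi_pos.ne' hf
  have hcl : e ∈ closure (D : Set E) := by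
    refine Metric.mem_closure_iff.2 fun δ hδ => ?_
    obtain ⟨p, hp, h⟩ := exists_isTrigPoly_abs_iteratedDeriv_sub_lt k hf hper (half_pos hδ)
    obtain ⟨d, hd⟩ := hp.periodic.exists_boundedContinuousFunction_eq_iteratedDeriv
      Real.two_pi_pos.ne' (hp.contDiff k)
    refine ⟨d, ⟨p, hp, hd⟩, lt_of_le_of_lt ?_ (half_lt_self hδ)⟩
    refine (dist_pi_le_iff (half_pos hδ).le).2 fun i =>
      (BoundedContinuousFunction.dist_le (half_pos hδ).le).2 fun x => ?_
    rw [he, hd, Real.dist_eq]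
    exact (h i (Nat.le_of_lt_succ i.2) x).le
  obtain ⟨d, ⟨p, hp, hd⟩, hLd, hnorm⟩ := D.exists_mem_map_eq_norm_sub_lt L hcl hε
  refine ⟨p, hp, fun i hi j => ?_, fun i hi x => ?_⟩
  · rw [← hd ⟨i, Nat.lt_succ_of_le hi⟩, ← he ⟨i, Nat.lt_succ_of_le hi⟩]
    exact congrFun hLd (⟨i, Nat.lt_succ_of_le hi⟩, j)
  · rw [← hd ⟨i, Nat.lt_succ_of_le hi⟩, ← he ⟨i, Nat.lt_succ_of_le hi⟩]
    exact (((e - d) _).norm_coe_le_norm x).trans_lt ((norm_le_pi_norm (e - d) _).trans_lt hnorm)
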